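/- arXiv:math/0407019 — 3 statements merged into one kernel-verified Lean document; each statement's English description precedes it below -/
import Mathlib

section
/- Let f : C → D and g : D → C be mutually inverse isomorphisms in 𝒞, and let C̄, D̄ be objects of 𝒞̄ with F(C̄) = C and F(D̄) = D. Then for every morphism f̄ : C̄ → D̄ with F(f̄) = f there exists a morphism ḡ : D̄ → C̄ with F(ḡ) = g such that f̄ and ḡ are mutually inverse isomorphisms in 𝒞̄; in particular C̄ and D̄ are isomorphic. -/
open CategoryTheory

namespace Paper

/-- A graded object: a `ℤ`-indexed family of objects. -/
abbrev GradedObj (A : Type*) [Category A] := ℤ → A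

/-- A graded map of degree `n` from `X` to `Y`. -/
abbrev GMap {A : Type*} [Category A] (X Y : GradedObj A) (n : ℤ) :=
  ∀ i : ℤ, X i ⟶ Y (i + n)

/-- Composition of graded maps, in diagrammatic order (`gcomp h f g` is "`g ∘ f`"),
with prescribed total degree `k = n + m`. -/
def gcomp {A : Type*} [Category A] {X Y Z : GradedObj A} {n m k : ℤ} (h : n + m = k)
    (f : GMap X Y n) (g : GMap Y Z m) : GMap X Z k :=
  fun i => f i ≫ g (i + n) ≫ eqToHom (congrArg Z (show i + n + m = i + k by omega))

/-- The identity graded map of degree `0`. -/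
def gid {A : Type*} [Category A] (X : GradedObj A) : GMap X X 0 :=
  fun i => eqToHom (congrArg X (add_zero i).symm)

/-- `δ(f) = d_Y ∘ f - (-1)ⁿ ⬝ f ∘ d_X` for pre-differentials `d_X`, `d_Y` and a graded
map `f` of degree `n`; the result has degree `m = n + 1`. -/
def gdelta {A : Type*} [Category A] [Preadditive A] {X Y : GradedObj A}
    (dX : GMap X X 1) (dY : GMap Y Y 1) {n m : ℤ} (h : n + 1 = m) (f : GMap X Y n) :
    GMap X Y m :=
  gcomp h f dY - (n.negOnePow : ℤ) • gcomp (show 1 + n = m by omega) dX f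

/-- The image of a graded object under a functor. -/
abbrev Fgr {A B : Type*} [Category A] [Category B] (F : B ⥤ A) (X : GradedObj B) :
    GradedObj A := fun i => F.obj (X i)

/-- The image of a graded map under a functor. -/
def Fmap {A B : Type*} [Category A] [Category B] (F : B ⥤ A) {X Y : GradedObj B} {n : ℤ}
    (f : GMap X Y n) : GMap (Fgr F X) (Fgr F Y) n := fun i => F.map (f i)

/-- `Ker(F)² = 0`: the composite of two `F`-killed morphisms vanishes. -/
def KerSq {A B : Type*} [Category A] [Category B] [Preadditive A] [Preadditive B]
    (F : B ⥤ A) : Prop :=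
  ∀ ⦃X Y Z : B⦄ (u : X ⟶ Y) (v : Y ⟶ Z), F.map u = 0 → F.map v = 0 → u ≫ v = 0

/-- `f : (X,dX) → (Y,dY)` and `g : (Y,dY) → (X,dX)` are cochain maps which are homotopy
inverse to each other. -/
def IsHomotopyEquivPair {A : Type*} [Category A] [Preadditive A] {X Y : GradedObj A}
    (dX : GMap X X 1) (dY : GMap Y Y 1) (f : GMap X Y 0) (g : GMap Y X 0) : Prop :=
  gdelta dX dY (show (0:ℤ) + 1 = 1 by omega) f = 0 ∧
  gdelta dY dX (show (0:ℤ) + 1 = 1 by omega) g = 0 ∧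
  (∃ H : GMap X X (-1), gdelta dX dX (show (-1:ℤ) + 1 = 0 by omega) H
      = gid X - gcomp (show (0:ℤ) + 0 = 0 by omega) f g) ∧
  (∃ K : GMap Y Y (-1), gdelta dY dY (show (-1:ℤ) + 1 = 0 by omega) K
      = gid Y - gcomp (show (0:ℤ) + 0 = 0 by omega) g f)


/-- If `F` has square-zero kernel and `F` sends `b ≫ a` to the identity, then
`a + a - a ≫ b ≫ a` is a strict inverse of `b` on the right. -/
theorem KerSq.comp_sub_eq_id {A B : Type*} [Category A] [Category B] [Preadditive A]
    [Preadditive B] {F : B ⥤ A} [F.Additive] (hF : KerSq F) {X Y : B} {b : X ⟶ Y} {a : Y ⟶ X}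
    (h : F.map b ≫ F.map a = 𝟙 (F.obj X)) :
    b ≫ (a + a - a ≫ b ≫ a) = 𝟙 X := by
  have hu : F.map (𝟙 X - b ≫ a) = 0 := by simp [h]
  have hsq := hF _ _ hu hu
  simp only [Preadditive.comp_sub, Preadditive.sub_comp, Preadditive.comp_add, Category.id_comp,
    Category.comp_id, Category.assoc] at hsq ⊢
  rw [← sub_eq_zero, ← neg_eq_zero, ← hsq]
  abel

/-- If `F` has square-zero kernel and `F` sends `a ≫ b` to the identity, then
`a + a - a ≫ b ≫ a` is a strict inverse of `b` on the left. -/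
theorem KerSq.sub_comp_eq_id {A B : Type*} [Category A] [Category B] [Preadditive A]
    [Preadditive B] {F : B ⥤ A} [F.Additive] (hF : KerSq F) {X Y : B} {b : X ⟶ Y} {a : Y ⟶ X}
    (h : F.map a ≫ F.map b = 𝟙 (F.obj Y)) :
    (a + a - a ≫ b ≫ a) ≫ b = 𝟙 Y := by
  have hu : F.map (𝟙 Y - a ≫ b) = 0 := by simp [h]
  have hsq := hF _ _ hu hu
  simp only [Preadditive.comp_sub, Preadditive.sub_comp, Preadditive.add_comp, Category.id_comp,
    Category.comp_id, Category.assoc] at hsq ⊢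
  rw [← sub_eq_zero, ← neg_eq_zero, ← hsq]
  abel

/-- lifting inverse isomorphisms along a full additive functor with
`Ker(F)² = 0`. -/
theorem statement0 {B C : Type*} [Category B] [Preadditive B] [Category C] [Preadditive C]
    (F : B ⥤ C) [F.Additive] [F.Full] (hF : KerSq F)
    {Cb Db : B} (f : F.obj Cb ⟶ F.obj Db) (g : F.obj Db ⟶ F.obj Cb)
    (hfg : f ≫ g = 𝟙 (F.obj Cb)) (hgf : g ≫ f = 𝟙 (F.obj Db))
    (fb : Cb ⟶ Db) (hfb : F.map fb = f) :
    (∃ gb : Db ⟶ Cb, F.map gb = g ∧ fb ≫ gb = 𝟙 Cb ∧ gb ≫ fb = 𝟙 Db) ∧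
    Nonempty (Cb ≅ Db) := by
  subst hfb
  obtain ⟨a, rfl⟩ := F.map_surjective g
  have hr := hF.comp_sub_eq_id hfg
  have hl := hF.sub_comp_eq_id hgf
  refine ⟨⟨a + a - a ≫ fb ≫ a, ?_, hr, hl⟩, ⟨⟨fb, _, hr, hl⟩⟩⟩
  simp [F.map_sub, F.map_add, hfg]

end Paper
end

section
/- Let (C•,d) be a cochain complex in 𝒞 (so d is a pre-differential with d² = 0) and let C̄• be a graded lift of C• along F. Let d̄ be any graded lift of d, and for a graded map x of degree m set δ̄(x) = d̄∘x − (−1)ᵐ x∘d̄. Then F(d̄²) = 0 and δ̄(d̄²) = 0, and there exists a differential d̄′ on C̄• with F(d̄′) = d (that is, a lift of the complex (C•,d) along the induced functor on cochain complexes) if and only if d̄² + δ̄(∂) = 0, i.e. d̄² + d̄∘∂ + ∂∘d̄ = 0, for some graded map ∂ of degree 1 with F(∂) = 0. -/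
open CategoryTheory

namespace Paper

/-- Graded maps commute with transport along an equality of degrees. -/
lemma GMap.comp_eqToHom {A : Type*} [Category A] {X Y : GradedObj A} {n : ℤ}
    (f : GMap X Y n) {i j : ℤ} (h : i = j) :
    eqToHom (congrArg X h) ≫ f j = f i ≫ eqToHom (congrArg (fun k => Y (k + n)) h) := by
  subst h
  simp

lemma gcomp_assoc {A : Type*} [Category A] {W X Y Z : GradedObj A} {a b c ab bc abc : ℤ}
    (hab : a + b = ab) (hbc : b + c = bc) (h₁ : ab + c = abc) (h₂ : a + bc = abc)
    (f : GMap W X a) (g : GMap X Y b) (k : GMap Y Z c) :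
    gcomp h₁ (gcomp hab f g) k = gcomp h₂ f (gcomp hbc g k) := by
  funext i
  have hi : i + a + b = i + ab := by omega
  simp only [gcomp, Category.assoc]
  rw [← Category.assoc (eqToHom _) (k _), GMap.comp_eqToHom k hi]
  simp

section Preadditive

variable {A : Type*} [Category A] [Preadditive A] {X Y Z : GradedObj A} {n m k : ℤ}

lemma add_gcomp (h : n + m = k) (f f' : GMap X Y n) (g : GMap Y Z m) :
    gcomp h (f + f') g = gcomp h f g + gcomp h f' g := by
  funext i
  simp [gcomp]

lemma gcomp_add (h : n + m = k) (f : GMap X Y n) (g g' : GMap Y Z m) :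
    gcomp h f (g + g') = gcomp h f g + gcomp h f g' := by
  funext i
  simp [gcomp]

end Preadditive

section Functor

variable {A B : Type*} [Category A] [Category B] (F : B ⥤ A)

lemma Fmap_gcomp {X Y Z : GradedObj B} {n m k : ℤ} (h : n + m = k)
    (f : GMap X Y n) (g : GMap Y Z m) :
    Fmap F (gcomp h f g) = gcomp h (Fmap F f) (Fmap F g) := by
  funext i
  simp [Fmap, gcomp, eqToHom_map]

variable [Preadditive A] [Preadditive B] [F.Additive] {X Y : GradedObj B} {n : ℤ}

lemma Fmap_add (f g : GMap X Y n) : Fmap F (f + g) = Fmap F f + Fmap F g := by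
  funext i
  simp [Fmap]

lemma Fmap_sub (f g : GMap X Y n) : Fmap F (f - g) = Fmap F f - Fmap F g := by
  funext i
  simp [Fmap]

end Functor

lemma KerSq.gcomp_eq_zero {A B : Type*} [Category A] [Category B] [Preadditive A]
    [Preadditive B] {F : B ⥤ A} (hF : KerSq F) {X Y Z : GradedObj B} {n m k : ℤ}
    (h : n + m = k) {f : GMap X Y n} {g : GMap Y Z m} (hf : Fmap F f = 0)
    (hg : Fmap F g = 0) : gcomp h f g = 0 := by
  funext i
  have hfg := hF (f i) (g (i + n)) (congrFun hf i) (congrFun hg (i + n))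
  simp only [gcomp, ← Category.assoc, hfg, Limits.zero_comp, Pi.zero_apply]

/-- Perturbing `d` by an `F`-killed graded map changes its square only to first order. -/
lemma KerSq.gcomp_add_self {A B : Type*} [Category A] [Category B] [Preadditive A]
    [Preadditive B] {F : B ⥤ A} (hF : KerSq F) {X : GradedObj B} {n k : ℤ} (h : n + n = k)
    (d : GMap X X n) {p : GMap X X n} (hp : Fmap F p = 0) :
    gcomp h (d + p) (d + p) = gcomp h d d + gcomp h p d + gcomp h d p := by
  rw [gcomp_add, add_gcomp, add_gcomp, hF.gcomp_eq_zero h hp hp, add_zero]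

/-- obstruction theory for lifting a differential to a fixed graded lift:
for any graded lift `d̄` of `d`, `F(d̄²) = 0` and `δ̄(d̄²) = 0`, and `d` lifts to a
differential on the graded lift iff `d̄² + d̄∘∂ + ∂∘d̄ = 0` for some `F`-killed graded map
`∂` of degree `1`. -/
theorem statement5 {B C : Type*} [Category B] [Preadditive B] [Category C] [Preadditive C]
    (F : B ⥤ C) [F.Additive] [F.Full] (hF : KerSq F)
    (Xb : GradedObj B)
    (d : GMap (Fgr F Xb) (Fgr F Xb) 1)
    (hd : gcomp (show (1:ℤ) + 1 = 2 by omega) d d = 0)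
    (db : GMap Xb Xb 1) (hdb : Fmap F db = d) :
    Fmap F (gcomp (show (1:ℤ) + 1 = 2 by omega) db db) = 0 ∧
    gdelta db db (show (2:ℤ) + 1 = 3 by omega)
      (gcomp (show (1:ℤ) + 1 = 2 by omega) db db) = 0 ∧
    ((∃ db' : GMap Xb Xb 1, Fmap F db' = d ∧
        gcomp (show (1:ℤ) + 1 = 2 by omega) db' db' = 0) ↔
      (∃ p : GMap Xb Xb 1, Fmap F p = 0 ∧
        gcomp (show (1:ℤ) + 1 = 2 by omega) db db
          + gcomp (show (1:ℤ) + 1 = 2 by omega) p db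
          + gcomp (show (1:ℤ) + 1 = 2 by omega) db p = 0)) := by
  refine ⟨by rw [Fmap_gcomp, hdb, hd], ?_, ?_, ?_⟩
  · have h2 : ((2 : ℤ).negOnePow : ℤ) = 1 := by
      rw [Int.negOnePow_even 2 even_two, Units.val_one]
    rw [gdelta, h2, one_smul, sub_eq_zero]
    exact gcomp_assoc _ _ _ _ db db db
  · rintro ⟨db', hdb', hsq⟩
    have hp : Fmap F (db' - db) = 0 := by rw [Fmap_sub, hdb', hdb, sub_self]
    refine ⟨db' - db, hp, ?_⟩
    rw [← hF.gcomp_add_self _ db hp, add_sub_cancel, hsq]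
  · rintro ⟨p, hp, h⟩
    refine ⟨db + p, by rw [Fmap_add, hdb, hp, add_zero], ?_⟩
    rw [hF.gcomp_add_self _ db hp, h]

end Paper
end

section
/- Let (C•,d_C), (D•,d_D) be cochain complexes in 𝒞, let f : C• → D• and g : D• → C• be cochain maps of degree 0, and let H : g∘f → 1_{C•} and K : f∘g → 1_{D•} be homotopies. Fix graded lifts C̄•, D̄• along F and suppose d̄_D is a differential on D̄• with F(d̄_D) = d_D. Then there exists a differential d̄_C on C̄• with F(d̄_C) = d_C together with a cochain map f̄ : (C̄•,d̄_C) → (D̄•,d̄_D) with F(f̄) = f. -/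
open CategoryTheory

namespace Paper

/-- A graded map of degree `0`, read as a family `X i ⟶ Y i`. -/
def GMap.zeroComponent {A : Type*} [Category A] {X Y : GradedObj A} (f : GMap X Y 0) (i : ℤ) :
    X i ⟶ Y i :=
  f i ≫ eqToHom (congrArg Y (add_zero i))

/-- A graded map of degree `-1`, read as a family `X (i + 1) ⟶ Y i`. -/
def GMap.negOneComponent {A : Type*} [Category A] {X Y : GradedObj A} (f : GMap X Y (-1))
    (i : ℤ) : X (i + 1) ⟶ Y i :=
  f (i + 1) ≫ eqToHom (congrArg Y (add_neg_cancel_right i 1))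

lemma gcomp_one_one_eq_zero_iff {A : Type*} [Category A] [Preadditive A] {X : GradedObj A}
    (d : GMap X X 1) (h : (1 : ℤ) + 1 = 2) :
    gcomp h d d = 0 ↔ ∀ i, d i ≫ d (i + 1) = 0 := by
  rw [funext_iff]
  refine forall_congr' fun i => ?_
  simp only [gcomp, Pi.zero_apply, ← Category.assoc]
  exact Preadditive.IsIso.comp_right_eq_zero _ _

lemma gdelta_zero_eq_zero_iff {A : Type*} [Category A] [Preadditive A] {X Y : GradedObj A}
    (dX : GMap X X 1) (dY : GMap Y Y 1) (f : GMap X Y 0) (h : (0 : ℤ) + 1 = 1) :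
    gdelta dX dY h f = 0 ↔
      ∀ i, f.zeroComponent i ≫ dY i = dX i ≫ f.zeroComponent (i + 1) := by
  rw [funext_iff]
  refine forall_congr' fun i => ?_
  have e := eqToHom_naturality (f := Y) (g := fun i => Y (i + 1)) dY (add_zero i)
  simp only [gdelta, gcomp, GMap.zeroComponent, Pi.sub_apply, Pi.zero_apply,
    Int.negOnePow_zero, Units.val_one, one_smul, sub_eq_zero, Category.assoc]
  rw [← e]

lemma negOneComponent_comp_add {A : Type*} [Category A] [Preadditive A] {X Y : GradedObj A}
    {d : GMap X X 1} {f : GMap X Y 0} {g : GMap Y X 0} {H : GMap X X (-1)}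
    {h : (-1 : ℤ) + 1 = 0} {h' : (0 : ℤ) + 0 = 0}
    (hH : gdelta d d h H = gid X - gcomp h' f g) (i : ℤ) :
    H.negOneComponent i ≫ d i + d (i + 1) ≫ H.negOneComponent (i + 1) =
      𝟙 (X (i + 1)) - f.zeroComponent (i + 1) ≫ g.zeroComponent (i + 1) := by
  have e₁ := eqToHom_naturality (f := X) (g := fun i => X (i + 1)) d
    (add_neg_cancel_right i 1)
  have e₂ := eqToHom_naturality (f := Y) (g := fun i => X (i + 0)) g (add_zero (i + 1))
  have e₃ := congrArg (· ≫ eqToHom (congrArg X (add_zero (i + 1)))) (congrFun hH (i + 1))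
  simp only [gdelta, gcomp, gid, Pi.sub_apply, Pi.neg_apply, Int.negOnePow_neg,
    Int.negOnePow_one, Units.val_neg, Units.val_one, neg_smul, one_smul, sub_neg_eq_add,
    Preadditive.add_comp, Preadditive.sub_comp, Category.assoc, eqToHom_trans,
    eqToHom_refl] at e₃
  simp only [GMap.zeroComponent, GMap.negOneComponent, Category.assoc]
  rw [← reassoc_of% e₂, ← e₁, eqToHom_trans, ← e₃]

section KerSq

variable {B C : Type*} [Category B] [Preadditive B] [Category C] [Preadditive C]
  {F : B ⥤ C} [F.Additive]

lemma KerSq.comp_congr_right (hF : KerSq F) {X Y Z : B} {k : X ⟶ Y} {u v : Y ⟶ Z}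
    (hk : F.map k = 0) (huv : F.map u = F.map v) : k ≫ u = k ≫ v := by
  rw [← sub_eq_zero, ← Preadditive.comp_sub]
  exact hF _ _ hk (by rw [F.map_sub, huv, sub_self])

/-- If a homotopy equivalence in `C` is lifted to graded maps `φ`, `γ`, `H`, `K` of `B`, and
the lift `D` of the target differential squares to zero, then the lifts `d` of the source
differential and `φ` can be corrected by maps killed by `F` so that `d` squares to zero and
`φ` is a cochain map. -/
lemma KerSq.exists_correction (hF : KerSq F) {X Y : ℤ → B}
    (d : ∀ i, X i ⟶ X (i + 1)) (D : ∀ i, Y i ⟶ Y (i + 1))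
    (φ : ∀ i, X i ⟶ Y i) (γ : ∀ i, Y i ⟶ X i)
    (H : ∀ i, X (i + 1) ⟶ X i) (K : ∀ i, Y (i + 1) ⟶ Y i)
    (hd : ∀ i, F.map (d i) ≫ F.map (d (i + 1)) = 0)
    (hD : ∀ i, D i ≫ D (i + 1) = 0)
    (hφ : ∀ i, F.map (φ i) ≫ F.map (D i) = F.map (d i) ≫ F.map (φ (i + 1)))
    (hγ : ∀ i, F.map (γ i) ≫ F.map (d i) = F.map (D i) ≫ F.map (γ (i + 1)))
    (hH : ∀ i, F.map (H i) ≫ F.map (d i) + F.map (d (i + 1)) ≫ F.map (H (i + 1)) =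
      𝟙 _ - F.map (φ (i + 1)) ≫ F.map (γ (i + 1)))
    (hK : ∀ i, F.map (K i) ≫ F.map (D i) + F.map (D (i + 1)) ≫ F.map (K (i + 1)) =
      𝟙 _ - F.map (γ (i + 1)) ≫ F.map (φ (i + 1))) :
    ∃ (a : ∀ i, X i ⟶ X (i + 1)) (b : ∀ i, X i ⟶ Y i),
      (∀ i, F.map (a i) = 0) ∧ (∀ i, F.map (b i) = 0) ∧
      (∀ i, (d i + a i) ≫ (d (i + 1) + a (i + 1)) = 0) ∧
      ∀ i, (φ i + b i) ≫ D i = (d i + a i) ≫ (φ (i + 1) + b (i + 1)) := by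
  obtain ⟨o, ho⟩ : ∃ o : ∀ i, X i ⟶ X (i + 1 + 1), ∀ i, o i = d i ≫ d (i + 1) :=
    ⟨_, fun _ => rfl⟩
  obtain ⟨z, hz⟩ : ∃ z : ∀ i, X i ⟶ Y (i + 1), ∀ i, z i =
      o i ≫ (φ (i + 1 + 1) ≫ K (i + 1) - H (i + 1) ≫ φ (i + 1)) := ⟨_, fun _ => rfl⟩
  obtain ⟨q, hq⟩ : ∃ q : ∀ i, X i ⟶ Y (i + 1), ∀ i, q i =
      φ i ≫ D i - d i ≫ φ (i + 1) - z i := ⟨_, fun _ => rfl⟩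
  have Fo (i) : F.map (o i) = 0 := by rw [ho, F.map_comp, hd]
  have Fz (i) : F.map (z i) = 0 := by rw [hz, F.map_comp, Fo, Limits.zero_comp]
  have Fq (i) : F.map (q i) = 0 := by
    rw [hq, F.map_sub, F.map_sub, F.map_comp, F.map_comp, hφ, Fz, sub_self, sub_zero]
  have d_o (i) : d i ≫ o (i + 1) = o i ≫ d (i + 1 + 1) := by simp only [ho, Category.assoc]
  have δz (i) : z i ≫ D (i + 1) + d i ≫ z (i + 1) = 0 := by
    rw [hz, hz, reassoc_of% d_o, Category.assoc, ← Preadditive.comp_add]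
    refine hF _ _ (Fo i) ?_
    simp only [F.map_add, F.map_sub, F.map_comp, Preadditive.comp_sub, Preadditive.sub_comp,
      Category.assoc]
    rw [← reassoc_of% hφ, hφ, eq_sub_of_add_eq (hK (i + 1)),
      ← Category.assoc (F.map (d _)) (F.map (H _)), eq_sub_of_add_eq' (hH (i + 1))]
    simp only [Preadditive.comp_sub, Preadditive.sub_comp, Category.assoc, Category.id_comp,
      Category.comp_id]
    abel
  have δq (i) : d i ≫ q (i + 1) = - (o i ≫ φ (i + 1 + 1)) - q i ≫ D (i + 1) := by
    have e := eq_neg_of_add_eq_zero_right (δz i)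
    rw [hq, hq, Preadditive.comp_sub, e, ho]
    simp only [Preadditive.comp_sub, Preadditive.sub_comp, Category.assoc, hD,
      Limits.comp_zero]
    abel
  have Fa (i) : F.map (q i ≫ γ (i + 1) - o i ≫ H (i + 1)) = 0 := by
    simp [Fq, Fo]
  have Fb (i) : F.map (-(q i ≫ K i)) = 0 := by simp [Fq]
  refine ⟨_, _, Fa, Fb, fun i => ?_, fun i => ?_⟩
  · have hqγ : q i ≫ γ (i + 1) ≫ d (i + 1) = q i ≫ D (i + 1) ≫ γ (i + 1 + 1) :=
      hF.comp_congr_right (Fq i) (by simpa using hγ (i + 1))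
    have hoH : o i ≫ (H (i + 1) ≫ d (i + 1) + d (i + 1 + 1) ≫ H (i + 1 + 1)) =
        o i ≫ (𝟙 _ - φ (i + 1 + 1) ≫ γ (i + 1 + 1)) :=
      hF.comp_congr_right (Fo i) (by simpa using hH (i + 1))
    rw [Preadditive.comp_add, Preadditive.add_comp, Preadditive.add_comp,
      hF _ _ (Fa i) (Fa (i + 1)), ← ho]
    simp only [Preadditive.comp_sub, Preadditive.sub_comp, Category.assoc, hqγ,
      reassoc_of% δq, reassoc_of% d_o, Preadditive.neg_comp]
    simp only [Preadditive.comp_sub, Preadditive.comp_add, Category.comp_id] at hoH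
    linear_combination (norm := abel) -hoH
  · have hqK : q i ≫ (K i ≫ D i + D (i + 1) ≫ K (i + 1)) =
        q i ≫ (𝟙 _ - γ (i + 1) ≫ φ (i + 1)) :=
      hF.comp_congr_right (Fq i) (by simpa using hK i)
    rw [Preadditive.comp_add _ _ _ (d i + _), Preadditive.add_comp, Preadditive.add_comp,
      Preadditive.add_comp, hF _ _ (Fa i) (Fb (i + 1))]
    have hqi := hq i
    rw [hz] at hqi
    simp only [Preadditive.comp_sub, Preadditive.sub_comp, Preadditive.comp_add,
      Preadditive.comp_neg, Preadditive.neg_comp, Category.assoc,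
      reassoc_of% δq, Category.comp_id] at hqK hqi ⊢
    linear_combination (norm := abel) -hqK - hqi

end KerSq

/-- Theorem `comp2`(1), crude lifting: given complexes `(C,d_C)`, `(D,d_D)`
in `𝒞`, cochain maps `f`, `g` and homotopies `H : g∘f → 1`, `K : f∘g → 1`, graded lifts
`C̄`, `D̄` and a lifted differential `d̄_D` on `D̄`, there is a lifted differential `d̄_C` on
`C̄` together with a cochain-map lift `f̄` of `f`. -/
theorem statement7 {B C : Type*} [Category B] [Preadditive B] [Category C] [Preadditive C]
    (F : B ⥤ C) [F.Additive] [F.Full] (hF : KerSq F)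
    (Xb Yb : GradedObj B)
    (dC : GMap (Fgr F Xb) (Fgr F Xb) 1) (dD : GMap (Fgr F Yb) (Fgr F Yb) 1)
    (hdC : gcomp (show (1:ℤ) + 1 = 2 by omega) dC dC = 0)
    (hdD : gcomp (show (1:ℤ) + 1 = 2 by omega) dD dD = 0)
    (f : GMap (Fgr F Xb) (Fgr F Yb) 0) (g : GMap (Fgr F Yb) (Fgr F Xb) 0)
    (hf : gdelta dC dD (show (0:ℤ) + 1 = 1 by omega) f = 0)
    (hg : gdelta dD dC (show (0:ℤ) + 1 = 1 by omega) g = 0)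
    (H : GMap (Fgr F Xb) (Fgr F Xb) (-1))
    (hH : gdelta dC dC (show (-1:ℤ) + 1 = 0 by omega) H
      = gid (Fgr F Xb) - gcomp (show (0:ℤ) + 0 = 0 by omega) f g)
    (K : GMap (Fgr F Yb) (Fgr F Yb) (-1))
    (hK : gdelta dD dD (show (-1:ℤ) + 1 = 0 by omega) K
      = gid (Fgr F Yb) - gcomp (show (0:ℤ) + 0 = 0 by omega) g f)
    (dDb : GMap Yb Yb 1) (hdDb : Fmap F dDb = dD)
    (hdDbsq : gcomp (show (1:ℤ) + 1 = 2 by omega) dDb dDb = 0) :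
    ∃ dCb : GMap Xb Xb 1, Fmap F dCb = dC ∧
      gcomp (show (1:ℤ) + 1 = 2 by omega) dCb dCb = 0 ∧
      ∃ fb : GMap Xb Yb 0, Fmap F fb = f ∧
        gdelta dCb dDb (show (0:ℤ) + 1 = 1 by omega) fb = 0 := by
  subst hdDb
  rw [gcomp_one_one_eq_zero_iff] at hdC hdDbsq
  rw [gdelta_zero_eq_zero_iff] at hf hg
  have hH' := negOneComponent_comp_add hH
  have hK' := negOneComponent_comp_add hK
  obtain ⟨a, b, Fa, Fb, hsq, hchain⟩ := hF.exists_correction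
    (fun i => F.preimage (dC i)) dDb
    (fun i => F.preimage (f.zeroComponent i)) (fun i => F.preimage (g.zeroComponent i))
    (fun i => F.preimage (H.negOneComponent i)) (fun i => F.preimage (K.negOneComponent i))
    (by simpa only [F.map_preimage] using hdC) hdDbsq
    (by simpa only [F.map_preimage] using! hf) (by simpa only [F.map_preimage] using! hg)
    (by simpa only [F.map_preimage] using hH') (by simpa only [F.map_preimage] using! hK')
  refine ⟨fun i => F.preimage (dC i) + a i, ?_, (gcomp_one_one_eq_zero_iff _ _).2 hsq,
    fun i => (F.preimage (f.zeroComponent i) + b i) ≫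
      eqToHom (congrArg Yb (add_zero i).symm), ?_, (gdelta_zero_eq_zero_iff _ _ _ _).2 ?_⟩
  · funext i
    simp [Fmap, Fa]
  · funext i
    simp [Fmap, Fb, GMap.zeroComponent, eqToHom_map]
  · simpa [GMap.zeroComponent] using hchain

end Paper
end
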